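/- arXiv:1709.04077 — 2 statements merged into one kernel-verified Lean document; each statement's English description precedes it below -/
import Mathlib

section
/- Let N ≥ 1, let f : ℝ^N → ℝ be continuous, and let δ > 0. Define f̂(x) = (1/vol(B₁)) ∫_{B₁} f(x + δu) du, where B₁ ⊆ ℝ^N is the closed Euclidean unit ball and vol is Lebesgue measure. Then f̂ is differentiable and for every x ∈ ℝ^N its gradient satisfies ∇f̂(x) = (N/δ) · (1/σ(S₁)) ∫_{S₁} f(x + δv) v dσ(v), where S₁ = {v ∈ ℝ^N : ‖v‖₂ = 1} is the unit sphere and σ is the surface (spherical) measure on S₁. Equivalently, the expectation over v drawn uniformly from the unit sphere of the point-wise gradient estimator g = (N/δ) f(x + δv) v equals the gradient of the smoothed function f̂ at x. -/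
open MeasureTheory

section SphereAverage

open Set Metric Filter Topology Module

theorem integral_eq_integral_Ioi_toSphere {E F : Type*} [NormedAddCommGroup E] [NormedSpace ℝ E]
    [MeasurableSpace E] [BorelSpace E] [FiniteDimensional ℝ E] [Nontrivial E]
    [NormedAddCommGroup F] [NormedSpace ℝ F] (μ : Measure E) [μ.IsAddHaarMeasure]
    {g : E → F} (hg : Integrable g μ) :
    ∫ x, g x ∂μ = ∫ r in Ioi (0 : ℝ), r ^ (finrank ℝ E - 1) •
      ∫ v : sphere (0 : E) 1, g (r • (v : E)) ∂μ.toSphere := by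
  have hmp := μ.measurePreserving_homeomorphUnitSphereProd
  have hemb := (homeomorphUnitSphereProd E).measurableEmbedding
  set G : sphere (0 : E) 1 × Ioi (0 : ℝ) → F := fun p => g ((p.2 : ℝ) • (p.1 : E)) with hG
  have hcomp : G ∘ homeomorphUnitSphereProd E = fun x : ({0}ᶜ : Set E) => g x := by
    ext x
    have h := congrArg Subtype.val ((homeomorphUnitSphereProd E).symm_apply_apply x)
    rw [homeomorphUnitSphereProd_symm_apply_coe] at h
    simp only [hG, Function.comp_apply, h]
  have hint : Integrable G (μ.toSphere.prod (.volumeIoiPow (finrank ℝ E - 1))) := by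
    rw [← hmp.integrable_comp_emb hemb, hcomp]
    exact (integrableOn_iff_comap_subtypeVal (measurableSet_singleton 0).compl).1 hg.integrableOn
  calc
    ∫ x, g x ∂μ = ∫ x : ({0}ᶜ : Set E), g x ∂(μ.comap (↑)) := by
      rw [integral_subtype_comap (measurableSet_singleton _).compl g, restrict_compl_singleton]
    _ = ∫ p, G p ∂μ.toSphere.prod (.volumeIoiPow (finrank ℝ E - 1)) := by
      rw [← hmp.integral_comp hemb]
      exact congrArg (integral _) hcomp.symm
    _ = ∫ r : Ioi (0 : ℝ), ∫ v : sphere (0 : E) 1, g ((r : ℝ) • (v : E)) ∂μ.toSphere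
          ∂.volumeIoiPow (finrank ℝ E - 1) := integral_prod_symm _ hint
    _ = _ := by
      simp only [Measure.volumeIoiPow, ENNReal.ofReal]
      rw [integral_withDensity_eq_integral_smul (by fun_prop),
        integral_subtype_comap measurableSet_Ioi fun r : ℝ => Real.toNNReal (r ^ (finrank ℝ E - 1)) •
          ∫ v : sphere (0 : E) 1, g (r • (v : E)) ∂μ.toSphere]
      refine setIntegral_congr_fun measurableSet_Ioi fun r hr => ?_
      simp only [NNReal.smul_def, Real.coe_toNNReal _ (pow_nonneg (le_of_lt hr) _)]

/-- A smooth radial profile, equal to `1` where `r ^ 2 ≤ 1 - 1 / c` and to `0` where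
`1 ≤ r ^ 2`. -/
noncomputable def ballCutoff (c r : ℝ) : ℝ := Real.smoothTransition (c * (1 - r ^ 2))

/-- The radial peak function `-∂ᵣ (ballCutoff c r)`. -/
noncomputable def ballCutoffPeak (c r : ℝ) : ℝ :=
  deriv Real.smoothTransition (c * (1 - r ^ 2)) * (2 * c * r)

theorem differentiable_smoothTransition : Differentiable ℝ Real.smoothTransition :=
  (Real.smoothTransition.contDiff (n := 1)).differentiable one_ne_zero

theorem continuous_deriv_smoothTransition : Continuous (deriv Real.smoothTransition) :=
  (Real.smoothTransition.contDiff (n := 1)).continuous_deriv le_rfl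

theorem deriv_smoothTransition_of_nonpos {t : ℝ} (ht : t ≤ 0) :
    deriv Real.smoothTransition t = 0 := by
  have h : IsLocalMin Real.smoothTransition t := by
    filter_upwards with s
    rw [Real.smoothTransition.zero_of_nonpos ht]
    exact Real.smoothTransition.nonneg s
  exact h.deriv_eq_zero

theorem deriv_smoothTransition_of_one_le {t : ℝ} (ht : 1 ≤ t) :
    deriv Real.smoothTransition t = 0 := by
  have h : IsLocalMax Real.smoothTransition t := by
    filter_upwards with s
    rw [Real.smoothTransition.one_of_one_le ht]
    exact Real.smoothTransition.le_one s
  exact h.deriv_eq_zero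

theorem hasDerivAt_ballCutoff (c r : ℝ) :
    HasDerivAt (ballCutoff c) (-ballCutoffPeak c r) r := by
  have h : HasDerivAt (fun r : ℝ => c * (1 - r ^ 2)) (c * -(2 * r)) r := by
    simpa using ((hasDerivAt_pow 2 r).const_sub 1).const_mul c
  have := (differentiable_smoothTransition (c * (1 - r ^ 2))).hasDerivAt.comp r h
  refine this.congr_deriv ?_
  rw [ballCutoffPeak]
  ring

theorem continuous_ballCutoffPeak (c : ℝ) : Continuous (ballCutoffPeak c) :=
  (continuous_deriv_smoothTransition.comp (by fun_prop)).mul (by fun_prop)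

theorem ballCutoffPeak_nonneg {c r : ℝ} (hc : 0 ≤ c) (hr : 0 ≤ r) : 0 ≤ ballCutoffPeak c r :=
  mul_nonneg Real.smoothTransition.monotone.deriv_nonneg (by positivity)

theorem ballCutoffPeak_of_one_le {c r : ℝ} (hc : 0 ≤ c) (hr : 1 ≤ r) : ballCutoffPeak c r = 0 := by
  rw [ballCutoffPeak, deriv_smoothTransition_of_nonpos, zero_mul]
  exact mul_nonpos_of_nonneg_of_nonpos hc (by nlinarith)

theorem ballCutoffPeak_of_le {c r η : ℝ} (hη : η ≤ 1) (hc : 1 ≤ c * η) (hc' : 0 ≤ c)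
    (hr : 0 ≤ r) (hrη : r ≤ 1 - η) : ballCutoffPeak c r = 0 := by
  rw [ballCutoffPeak, deriv_smoothTransition_of_one_le, zero_mul]
  have hη0 : 0 ≤ η := by
    by_contra! h
    nlinarith
  have : η ≤ 1 - r ^ 2 := by nlinarith
  nlinarith [mul_le_mul_of_nonneg_left this hc']

theorem integral_ballCutoffPeak {c : ℝ} (hc : 1 ≤ c) :
    ∫ r in (0 : ℝ)..1, ballCutoffPeak c r = 1 := by
  have h := intervalIntegral.integral_eq_sub_of_hasDerivAt (a := 0) (b := 1)
    (f := fun r => -ballCutoff c r) (f' := ballCutoffPeak c)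
    (fun r _ => (hasDerivAt_ballCutoff c r).neg.congr_deriv (neg_neg _))
    ((continuous_ballCutoffPeak c).intervalIntegrable _ _)
  rw [h]
  simp [ballCutoff, Real.smoothTransition.one_of_one_le hc]

/-- Integration against `ballCutoffPeak c` is an approximate evaluation at `r = 1`. -/
theorem norm_integral_ballCutoffPeak_smul_sub_le {F : Type*} [NormedAddCommGroup F]
    [NormedSpace ℝ F] [CompleteSpace F] {B : ℝ → F} (hB : Continuous B) {c η ε : ℝ} (hη : η ≤ 1)
    (hc : 1 ≤ c * η) (hc' : 1 ≤ c) (hε : ∀ r, 1 - η < r → r < 1 → ‖B r - B 1‖ ≤ ε) :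
    ‖(∫ r in Ioi (0 : ℝ), ballCutoffPeak c r • B r) - B 1‖ ≤ ε := by
  have hc0 : 0 ≤ c := by linarith
  have hk := continuous_ballCutoffPeak c
  have h1 : ∫ r in Ioi (0 : ℝ), ballCutoffPeak c r • B r =
      ∫ r in (0 : ℝ)..1, ballCutoffPeak c r • B r := by
    rw [intervalIntegral.integral_of_le zero_le_one]
    refine setIntegral_eq_of_subset_of_forall_sdiff_eq_zero measurableSet_Ioi Ioc_subset_Ioi_self ?_
    rintro r ⟨hr0, hr1⟩
    have : 1 ≤ r := by
      by_contra! h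
      exact hr1 ⟨hr0, h.le⟩
    rw [ballCutoffPeak_of_one_le hc0 this, zero_smul]
  have h2 : B 1 =
      ∫ r in (0 : ℝ)..1, ballCutoffPeak c r • B 1 := by
    rw [intervalIntegral.integral_smul_const, integral_ballCutoffPeak hc', one_smul]
  rw [h1, h2, ← intervalIntegral.integral_sub (f := fun r => ballCutoffPeak c r • B r)
    (g := fun r => ballCutoffPeak c r • B 1) ((hk.smul hB).intervalIntegrable _ _)
    ((hk.smul continuous_const).intervalIntegrable _ _)]
  calc _ ≤ ∫ r in (0 : ℝ)..1, ballCutoffPeak c r * ε := by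
        refine intervalIntegral.norm_integral_le_of_norm_le zero_le_one ?_
          ((hk.mul continuous_const).intervalIntegrable _ _)
        filter_upwards with r hr
        rw [← smul_sub, norm_smul, Real.norm_of_nonneg (ballCutoffPeak_nonneg hc0 hr.1.le)]
        rcases le_or_gt r (1 - η) with h | h
        · simp [ballCutoffPeak_of_le hη hc hc0 hr.1.le h]
        · rcases hr.2.eq_or_lt with rfl | h'
          · simp [ballCutoffPeak_of_one_le hc0 le_rfl]
          · exact mul_le_mul_of_nonneg_left (hε r h h') (ballCutoffPeak_nonneg hc0 hr.1.le)
    _ = ε := by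
        rw [intervalIntegral.integral_mul_const, integral_ballCutoffPeak hc', one_mul]

section InnerProductSpace

variable {E : Type*} [NormedAddCommGroup E] [InnerProductSpace ℝ E]

theorem hasFDerivAt_ballCutoff_norm (c : ℝ) (u : E) :
    HasFDerivAt (fun u : E => ballCutoff c ‖u‖)
      (-(deriv Real.smoothTransition (c * (1 - ‖u‖ ^ 2)) * (2 * c)) • innerSL ℝ u) u := by
  have h : HasFDerivAt (fun u : E => c * (1 - ‖u‖ ^ 2)) (c • -((2 : ℕ) • innerSL ℝ u : E →L[ℝ] ℝ)) u :=
    ((hasStrictFDerivAt_norm_sq u).hasFDerivAt.const_sub 1).const_mul c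
  refine ((differentiable_smoothTransition _).hasDerivAt.comp_hasFDerivAt u h).congr_fderiv ?_
  ext w
  simp
  ring

theorem contDiff_ballCutoff_norm (c : ℝ) : ContDiff ℝ 1 fun u : E => ballCutoff c ‖u‖ :=
  (Real.smoothTransition.contDiff (n := 1)).comp
    (contDiff_const.mul (contDiff_const.sub (contDiff_norm_sq ℝ)))

theorem ballCutoff_of_one_le {c r : ℝ} (hc : 0 ≤ c) (hr : 1 ≤ r) : ballCutoff c r = 0 :=
  Real.smoothTransition.zero_of_nonpos (mul_nonpos_of_nonneg_of_nonpos hc (by nlinarith))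

theorem hasCompactSupport_ballCutoff_norm [FiniteDimensional ℝ E] {c : ℝ} (hc : 0 ≤ c) :
    HasCompactSupport fun u : E => ballCutoff c ‖u‖ := by
  refine HasCompactSupport.intro (isCompact_closedBall (0 : E) 1) fun u hu => ?_
  rw [mem_closedBall_zero_iff, not_le] at hu
  exact ballCutoff_of_one_le hc hu.le

variable [FiniteDimensional ℝ E] [MeasurableSpace E] [BorelSpace E]
  (μ : Measure E) [μ.IsAddHaarMeasure]

theorem integrable_deriv_smoothTransition_smul {g : E → E} (hg : Continuous g) {c : ℝ}
    (hc : 0 ≤ c) :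
    Integrable (fun u => (deriv Real.smoothTransition (c * (1 - ‖u‖ ^ 2)) * (2 * c)) • g u) μ := by
  refine Continuous.integrable_of_hasCompactSupport ?_ ?_
  · exact ((continuous_deriv_smoothTransition.comp (by fun_prop)).mul continuous_const).smul hg
  · refine HasCompactSupport.intro (isCompact_closedBall (0 : E) 1) fun u hu => ?_
    rw [mem_closedBall_zero_iff, not_le] at hu
    rw [deriv_smoothTransition_of_nonpos, zero_mul, zero_smul]
    exact mul_nonpos_of_nonneg_of_nonpos hc (by nlinarith)

theorem hasFDerivAt_integral_ballCutoff_mul {f : E → ℝ} (hf : Continuous f) {c : ℝ} (hc : 0 ≤ c)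
    (x : E) :
    HasFDerivAt (fun x => ∫ u, ballCutoff c ‖u‖ * f (x + u) ∂μ)
      (innerSL ℝ (∫ u, (deriv Real.smoothTransition (c * (1 - ‖u‖ ^ 2)) * (2 * c)) •
        f (x + u) • u ∂μ)) x := by
  have hcs := hasCompactSupport_ballCutoff_norm (E := E) hc
  have h := hcs.hasFDerivAt_convolution_right (ContinuousLinearMap.mul ℝ ℝ)
    (hf.locallyIntegrable (μ := μ)) (contDiff_ballCutoff_norm c) x
  have hfun : (fun x => ∫ u, ballCutoff c ‖u‖ * f (x + u) ∂μ) =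
      convolution f (fun u : E => ballCutoff c ‖u‖) (ContinuousLinearMap.mul ℝ ℝ) μ := by
    ext y
    rw [convolution_def]
    refine Eq.trans ?_ (integral_add_left_eq_self _ y)
    simp [mul_comm]
  rw [hfun]
  refine h.congr_fderiv ?_
  have hfd : (fderiv ℝ fun u : E => ballCutoff c ‖u‖) = fun u : E =>
      -(deriv Real.smoothTransition (c * (1 - ‖u‖ ^ 2)) * (2 * c)) • innerSL ℝ u := by
    ext1 u
    exact (hasFDerivAt_ballCutoff_norm c u).fderiv
  rw [convolution_def, ← integral_add_left_eq_self (fun t => _) x, hfd,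
    ← ContinuousLinearMap.integral_comp_comm _ (integrable_deriv_smoothTransition_smul μ
      (by fun_prop : Continuous fun u => f (x + u) • u) hc)]
  refine integral_congr_ae (.of_forall fun u => ?_)
  ext w
  change f (x + u) * (-(deriv Real.smoothTransition (c * (1 - ‖x - (x + u)‖ ^ 2)) * (2 * c)) *
    inner ℝ (x - (x + u)) w) = inner ℝ (_ • f (x + u) • u) w
  rw [sub_add_cancel_left, norm_neg, inner_neg_left, real_inner_smul_left, real_inner_smul_left]
  ring

theorem integral_deriv_smoothTransition_smul_eq [Nontrivial E] {f : E → ℝ} (hf : Continuous f)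
    {c : ℝ} (hc : 0 ≤ c) (x : E) :
    ∫ u, (deriv Real.smoothTransition (c * (1 - ‖u‖ ^ 2)) * (2 * c)) • f (x + u) • u ∂μ =
      ∫ r in Ioi (0 : ℝ), ballCutoffPeak c r • r ^ (finrank ℝ E - 1) •
        ∫ v : sphere (0 : E) 1, f (x + r • (v : E)) • (v : E) ∂μ.toSphere := by
  rw [integral_eq_integral_Ioi_toSphere μ (integrable_deriv_smoothTransition_smul μ
      (by fun_prop : Continuous fun u => f (x + u) • u) hc)]
  refine setIntegral_congr_fun measurableSet_Ioi fun r hr => ?_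
  rw [smul_comm (ballCutoffPeak c r), ← integral_smul (ballCutoffPeak c r)]
  refine congrArg (_ • ·) (integral_congr_ae (.of_forall fun v => ?_))
  have hv : ‖(v : E)‖ = 1 := norm_eq_of_mem_sphere v
  simp only [norm_smul, hv, mul_one, Real.norm_eq_abs, sq_abs, ballCutoffPeak, smul_smul]
  ring_nf

theorem continuous_integral_toSphere {f : E → ℝ} (hf : Continuous f) :
    Continuous fun p : E × ℝ =>
      ∫ v : sphere (0 : E) 1, f (p.1 + p.2 • (v : E)) • (v : E) ∂μ.toSphere := by
  have := continuous_parametric_integral_of_continuous (μ := μ.toSphere)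
    (f := fun (p : E × ℝ) (v : sphere (0 : E) 1) => f (p.1 + p.2 • (v : E)) • (v : E))
    (by fun_prop) (isCompact_univ (X := sphere (0 : E) 1))
  simpa only [Measure.restrict_univ] using this

theorem tendsto_ballCutoff_atTop {r : ℝ} (hr : |r| < 1) :
    Tendsto (fun c => ballCutoff c r) atTop (𝓝 1) := by
  have h : 0 < 1 - r ^ 2 := by
    rw [sub_pos, sq_lt_one_iff_abs_lt_one]
    exact hr
  refine tendsto_const_nhds.congr' ?_
  filter_upwards [eventually_ge_atTop (1 - r ^ 2)⁻¹] with c hc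
  refine (Real.smoothTransition.one_of_one_le ?_).symm
  rwa [← inv_le_iff_one_le_mul₀ h]

theorem tendsto_integral_ballCutoff_mul [Nontrivial E] {f : E → ℝ} (hf : Continuous f) :
    Tendsto (fun c => ∫ u, ballCutoff c ‖u‖ * f u ∂μ) atTop
      (𝓝 (∫ u in closedBall (0 : E) 1, f u ∂μ)) := by
  have hball : ball (0 : E) 1 =ᵐ[μ] closedBall (0 : E) 1 :=
    ae_eq_of_subset_of_measure_ge ball_subset_closedBall
      (Measure.addHaar_closedBall_eq_addHaar_ball μ _ _).le measurableSet_ball.nullMeasurableSet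
      measure_closedBall_lt_top.ne
  rw [← setIntegral_congr_set hball, ← integral_indicator measurableSet_ball]
  have hint : Integrable ((closedBall (0 : E) 1).indicator fun u => |f u|) μ :=
    (hf.abs.continuousOn.integrableOn_compact (isCompact_closedBall _ _)).integrable_indicator
      measurableSet_closedBall
  refine tendsto_integral_filter_of_dominated_convergence _ ?_ ?_ hint ?_
  · exact .of_forall fun c => (((contDiff_ballCutoff_norm c).continuous).mul hf).aestronglyMeasurable
  · filter_upwards [eventually_ge_atTop 0] with c hc
    refine .of_forall fun u => ?_
    by_cases hu : u ∈ closedBall (0 : E) 1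
    · rw [indicator_of_mem hu, norm_mul, ballCutoff, Real.norm_of_nonneg (Real.smoothTransition.nonneg _)]
      exact mul_le_of_le_one_left (abs_nonneg _) (Real.smoothTransition.le_one _)
    · rw [mem_closedBall_zero_iff, not_le] at hu
      rw [ballCutoff_of_one_le hc hu.le, zero_mul, norm_zero]
      exact indicator_nonneg (fun _ _ => abs_nonneg _) _
  · refine .of_forall fun u => ?_
    by_cases hu : u ∈ ball (0 : E) 1
    · rw [indicator_of_mem hu]
      rw [mem_ball_zero_iff] at hu
      simpa using (tendsto_ballCutoff_atTop (r := ‖u‖) (by simpa using hu)).mul_const (f u)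
    · rw [indicator_of_notMem hu]
      rw [mem_ball_zero_iff, not_lt] at hu
      refine tendsto_const_nhds.congr' ?_
      filter_upwards [eventually_ge_atTop 0] with c hc
      rw [ballCutoff_of_one_le hc hu, zero_mul]

/-- The derivative of the integral of `f` over a moving unit ball is the flux of `f` through the
unit sphere. -/
theorem hasFDerivAt_setIntegral_closedBall_add [Nontrivial E] {f : E → ℝ} (hf : Continuous f)
    (x : E) :
    HasFDerivAt (fun x => ∫ u in closedBall (0 : E) 1, f (x + u) ∂μ)
      (innerSL ℝ (∫ v : sphere (0 : E) 1, f (x + v) • (v : E) ∂μ.toSphere)) x := by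
  set B : E × ℝ → E := fun p => p.2 ^ (finrank ℝ E - 1) •
    ∫ v : sphere (0 : E) 1, f (p.1 + p.2 • (v : E)) • (v : E) ∂μ.toSphere with hB
  have hBc : Continuous B :=
    (continuous_snd.pow _).smul (continuous_integral_toSphere μ hf)
  have hB1 : ∀ y, ∫ v : sphere (0 : E) 1, f (y + v) • (v : E) ∂μ.toSphere = B (y, 1) := by
    simp [hB]
  rw [hB1]
  refine hasFDerivAt_of_tendstoUniformlyOnFilter (l := (atTop : Filter ℝ))
    (f := fun c x => ∫ u, ballCutoff c ‖u‖ * f (x + u) ∂μ)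
    (f' := fun c x => innerSL ℝ (∫ r in Ioi (0 : ℝ), ballCutoffPeak c r • B (x, r)))
    (g' := fun x => innerSL ℝ (B (x, 1))) ?_ ?_ ?_
  · rw [Metric.tendstoUniformlyOnFilter_iff]
    intro ε hε
    have hnear := Metric.continuousAt_iff'.1 (hBc.continuousAt (x := (x, 1))) (ε / 4) (by positivity)
    rw [nhds_prod_eq] at hnear
    obtain ⟨U, hU, V, hV, hUV⟩ := eventually_prod_iff.1 hnear
    obtain ⟨η, hη, hηV⟩ := Metric.eventually_nhds_iff.1 hV
    have hη' : 0 < min η 1 := by positivity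
    refine eventually_prod_iff.2 ⟨fun c => (min η 1)⁻¹ ≤ c ∧ 1 ≤ c,
      (eventually_ge_atTop _).and (eventually_ge_atTop _), U, hU, ?_⟩
    rintro c ⟨hc, hc1⟩ y hy
    rw [dist_comm, dist_eq_norm, ← map_sub, innerSL_apply_norm]
    refine (norm_integral_ballCutoffPeak_smul_sub_le (ε := ε / 2) (η := min η 1)
      (hBc.comp (Continuous.prodMk_right y)) (min_le_right _ _) ?_ hc1 fun r hr hr1 => ?_).trans_lt
      (by linarith)
    · rwa [← inv_le_iff_one_le_mul₀ hη']
    · have h1 := hUV hy (hηV (y := r) (by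
        rw [Real.dist_eq, abs_lt]
        constructor <;> linarith [min_le_left η 1]))
      have h2 := hUV hy (hηV (y := 1) (by simpa using hη))
      rw [← dist_eq_norm]
      exact (dist_triangle_right _ _ (B (x, 1))).trans (by
        simp only [Function.comp_apply]
        linarith)
  · refine eventually_prod_iff.2 ⟨fun c => 0 ≤ c, eventually_ge_atTop 0, fun _ => True,
      .of_forall fun _ => trivial, fun {c} hc y _ => ?_⟩
    have := hasFDerivAt_integral_ballCutoff_mul μ hf hc y
    rwa [integral_deriv_smoothTransition_smul_eq μ hf hc] at this
  · exact .of_forall fun y => tendsto_integral_ballCutoff_mul μ (by fun_prop)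

end InnerProductSpace

end SphereAverage

/-- The δ-smoothed version `f̂` of a continuous function `f` is differentiable and
its gradient is `(N/δ)` times the average over the unit sphere (with respect to the
surface measure `volume.toSphere`) of `f(x + δv) v`; i.e. the expectation of the
point-wise gradient estimator `(N/δ) f(x + δv) v` over `v` uniform on the sphere
equals `∇f̂(x)`. -/
theorem stmt_6 (N : ℕ) (hN : 1 ≤ N)
    (f : EuclideanSpace ℝ (Fin N) → ℝ) (hf : Continuous f)
    (δ : ℝ) (hδ : 0 < δ)
    (fhat : EuclideanSpace ℝ (Fin N) → ℝ)
    (hfhat : ∀ x, fhat x =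
      ((volume (Metric.closedBall (0 : EuclideanSpace ℝ (Fin N)) 1)).toReal)⁻¹
        * ∫ u in Metric.closedBall (0 : EuclideanSpace ℝ (Fin N)) 1, f (x + δ • u)) :
    Differentiable ℝ fhat ∧
      ∀ x, gradient fhat x =
        ((N : ℝ) / δ) •
          ((((volume : Measure (EuclideanSpace ℝ (Fin N))).toSphere Set.univ).toReal)⁻¹ •
            ∫ v : Metric.sphere (0 : EuclideanSpace ℝ (Fin N)) 1,
              f (x + δ • (v : EuclideanSpace ℝ (Fin N))) • (v : EuclideanSpace ℝ (Fin N))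
              ∂((volume : Measure (EuclideanSpace ℝ (Fin N))).toSphere)) := by
  have : Nonempty (Fin N) := ⟨⟨0, hN⟩⟩
  have key : ∀ x, HasGradientAt fhat
      (((N : ℝ) / δ) •
          ((((volume : Measure (EuclideanSpace ℝ (Fin N))).toSphere Set.univ).toReal)⁻¹ •
            ∫ v : Metric.sphere (0 : EuclideanSpace ℝ (Fin N)) 1,
              f (x + δ • (v : EuclideanSpace ℝ (Fin N))) • (v : EuclideanSpace ℝ (Fin N))
              ∂((volume : Measure (EuclideanSpace ℝ (Fin N))).toSphere))) x := by
    intro x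
    have h := (hasFDerivAt_setIntegral_closedBall_add
      (volume : Measure (EuclideanSpace ℝ (Fin N)))
      (hf.comp (continuous_const_smul δ)) (δ⁻¹ • x)).comp x
      ((hasFDerivAt_id (𝕜 := ℝ) x).const_smul δ⁻¹)
    have h' := h.const_mul
      ((volume (Metric.closedBall (0 : EuclideanSpace ℝ (Fin N)) 1)).toReal)⁻¹
    have hδx : ∀ y : EuclideanSpace ℝ (Fin N), δ • δ⁻¹ • y = y := fun y =>
      smul_inv_smul₀ hδ.ne' y
    rw [hasGradientAt_iff_hasFDerivAt]
    have hfun : fhat = fun y =>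
        ((volume (Metric.closedBall (0 : EuclideanSpace ℝ (Fin N)) 1)).toReal)⁻¹ *
          ∫ u in Metric.closedBall (0 : EuclideanSpace ℝ (Fin N)) 1,
            (f ∘ fun z => δ • z) (δ⁻¹ • y + u) := by
      ext y
      simp only [hfhat, Function.comp_apply, smul_add, hδx]
    rw [hfun]
    refine h'.congr_fderiv ?_
    have hvol : ((volume : Measure (EuclideanSpace ℝ (Fin N))).toSphere Set.univ).toReal =
        N * (volume (Metric.closedBall (0 : EuclideanSpace ℝ (Fin N)) 1)).toReal := by
      rw [Measure.toSphere_apply_univ, Measure.addHaar_closedBall_eq_addHaar_ball]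
      simp
    have hN' : (N : ℝ) ≠ 0 := by positivity
    ext w
    simp only [hvol, Function.comp_apply, smul_add, hδx]
    simp
    field_simp
  exact ⟨fun x => (key x).differentiableAt, fun x => (key x).gradient⟩
end

section
/- Let T be a natural number with T ≥ 1, let a ≥ 0 and p ∈ ℝ with 0 ≤ p and p ≤ a / T^{1/3} and p ≤ 1, and let A₁, A₂ ≥ 0. Let R : ℕ → ℝ satisfy R(k) ≤ A₁ (T − k + 1)^{1/2} + A₂ (k + 1)^{3/4} for every k with 0 ≤ k ≤ T. Then Σ_{k=0}^T (T choose k) p^k (1−p)^{T−k} R(k) ≤ (A₁ + A₂ a^{3/4}) T^{1/2} + A₁ + A₂. -/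
theorem sum_binomial_weight (n : ℕ) (p : ℝ) :
    ∑ k ∈ Finset.range (n + 1), (n.choose k : ℝ) * p ^ k * (1 - p) ^ (n - k) = 1 := by
  simpa [bernsteinPolynomial, Polynomial.eval_finsetSum] using
    congrArg (Polynomial.eval p) (bernsteinPolynomial.sum ℝ n)

theorem sum_binomial_weight_mul_self (n : ℕ) (p : ℝ) :
    ∑ k ∈ Finset.range (n + 1), (n.choose k : ℝ) * p ^ k * (1 - p) ^ (n - k) * k = n * p := by
  simpa [bernsteinPolynomial, Polynomial.eval_finsetSum, mul_comm] using
    congrArg (Polynomial.eval p) (bernsteinPolynomial.sum_smul ℝ n)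

theorem sum_binomial_weight_mul_rpow_le (n : ℕ) {p q : ℝ} (hp0 : 0 ≤ p) (hp1 : p ≤ 1)
    (hq0 : 0 ≤ q) (hq1 : q ≤ 1) :
    ∑ k ∈ Finset.range (n + 1), (n.choose k : ℝ) * p ^ k * (1 - p) ^ (n - k) * (k : ℝ) ^ q
      ≤ (n * p) ^ q := by
  have hp1' : 0 ≤ 1 - p := sub_nonneg.2 hp1
  have h := (Real.concaveOn_rpow hq0 hq1).le_map_sum (t := Finset.range (n + 1))
    (w := fun k => (n.choose k : ℝ) * p ^ k * (1 - p) ^ (n - k)) (p := fun k => (k : ℝ))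
    (fun k _ => by positivity) (sum_binomial_weight n p) (fun k _ => Set.mem_Ici.2 k.cast_nonneg)
  simpa only [smul_eq_mul, sum_binomial_weight_mul_self] using h

theorem rpow_add_one_le {x q : ℝ} (hx : 0 ≤ x) (hq0 : 0 ≤ q) (hq1 : q ≤ 1) :
    (x + 1) ^ q ≤ x ^ q + 1 := by
  simpa using Real.rpow_add_le_add_rpow hx zero_le_one hq0 hq1

/-- Regret bound for `BerCOGD` (Theorem 3): taking the binomial expectation of the
conditional regret bound `R(k) ≤ A₁ (T - k + 1)^(1/2) + A₂ (k + 1)^(3/4)` under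
`p ≤ a / T^(1/3)` yields an `O(T^(1/2))` expected regret bound. -/
theorem stmt_13 (T : ℕ) (hT : 1 ≤ T) (a : ℝ) (ha : 0 ≤ a)
    (p : ℝ) (hp0 : 0 ≤ p) (hpa : p ≤ a / (T : ℝ) ^ ((1 : ℝ) / 3)) (hp1 : p ≤ 1)
    (A₁ A₂ : ℝ) (hA₁ : 0 ≤ A₁) (hA₂ : 0 ≤ A₂)
    (R : ℕ → ℝ)
    (hR : ∀ k, k ≤ T →
      R k ≤ A₁ * ((T : ℝ) - (k : ℝ) + 1) ^ ((1 : ℝ) / 2)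
            + A₂ * ((k : ℝ) + 1) ^ ((3 : ℝ) / 4)) :
    ∑ k ∈ Finset.range (T + 1),
        (T.choose k : ℝ) * p ^ k * (1 - p) ^ (T - k) * R k
      ≤ (A₁ + A₂ * a ^ ((3 : ℝ) / 4)) * (T : ℝ) ^ ((1 : ℝ) / 2) + A₁ + A₂ := by
  have hT0 : (0 : ℝ) < T := by exact_mod_cast hT
  have hp1' : 0 ≤ 1 - p := sub_nonneg.2 hp1
  have hTp : ((T : ℝ) * p) ^ ((3 : ℝ) / 4) ≤ a ^ ((3 : ℝ) / 4) * (T : ℝ) ^ ((1 : ℝ) / 2) := by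
    have hle : (T : ℝ) * p ≤ a * (T : ℝ) ^ ((2 : ℝ) / 3) := by
      calc (T : ℝ) * p ≤ T * (a / (T : ℝ) ^ ((1 : ℝ) / 3)) := by gcongr
        _ = a * ((T : ℝ) ^ (1 : ℝ) / (T : ℝ) ^ ((1 : ℝ) / 3)) := by rw [Real.rpow_one]; ring
        _ = a * (T : ℝ) ^ ((2 : ℝ) / 3) := by rw [← Real.rpow_sub hT0]; norm_num
    calc ((T : ℝ) * p) ^ ((3 : ℝ) / 4) ≤ (a * (T : ℝ) ^ ((2 : ℝ) / 3)) ^ ((3 : ℝ) / 4) := by gcongr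
      _ = a ^ ((3 : ℝ) / 4) * (T : ℝ) ^ ((1 : ℝ) / 2) := by
        rw [Real.mul_rpow ha (by positivity), ← Real.rpow_mul hT0.le]; norm_num
  have hterm : ∀ k ∈ Finset.range (T + 1),
      (T.choose k : ℝ) * p ^ k * (1 - p) ^ (T - k) * R k ≤
        (A₁ * ((T : ℝ) ^ ((1 : ℝ) / 2) + 1) + A₂) *
            ((T.choose k : ℝ) * p ^ k * (1 - p) ^ (T - k)) +
          A₂ * ((T.choose k : ℝ) * p ^ k * (1 - p) ^ (T - k) * (k : ℝ) ^ ((3 : ℝ) / 4)) := by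
    intro k hk
    have hkT : k ≤ T := Finset.mem_range_succ_iff.1 hk
    have hkT' : (k : ℝ) ≤ T := by exact_mod_cast hkT
    have hfull : ((T : ℝ) - k + 1) ^ ((1 : ℝ) / 2) ≤ (T : ℝ) ^ ((1 : ℝ) / 2) + 1 :=
      (Real.rpow_le_rpow (by linarith) (by linarith [k.cast_nonneg (α := ℝ)])
        (by norm_num)).trans (rpow_add_one_le hT0.le (by norm_num) (by norm_num))
    have hbandit : ((k : ℝ) + 1) ^ ((3 : ℝ) / 4) ≤ (k : ℝ) ^ ((3 : ℝ) / 4) + 1 :=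
      rpow_add_one_le k.cast_nonneg (by norm_num) (by norm_num)
    have hRk : R k ≤ A₁ * ((T : ℝ) ^ ((1 : ℝ) / 2) + 1) + A₂ * ((k : ℝ) ^ ((3 : ℝ) / 4) + 1) :=
      (hR k hkT).trans (by gcongr)
    refine (mul_le_mul_of_nonneg_left hRk (by positivity)).trans_eq ?_
    ring
  refine (Finset.sum_le_sum hterm).trans ?_
  rw [Finset.sum_add_distrib, ← Finset.mul_sum, ← Finset.mul_sum, sum_binomial_weight]
  have hmean := mul_le_mul_of_nonneg_left ((sum_binomial_weight_mul_rpow_le T (q := 3 / 4) hp0 hp1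
    (by norm_num) (by norm_num)).trans hTp) hA₂
  linarith
end
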